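/- Let K be an algebraically closed field, let S be a variety over K, let f : C → S be a proper morphism with C a separated scheme of finite type over K, and let U be an open subscheme of C such that the restriction f|_U : U → S is an affine morphism. Let T be an irreducible closed subset of the underlying topological space of C, equipped with its reduced induced closed subscheme structure, such that T is contained in U and the Krull dimension of T equals the Krull dimension of S. Then the restriction of f to T is a finite surjective morphism T → S. -/

import Mathlib

open AlgebraicGeometry CategoryTheory

/-- A variety over `K`: an integral scheme, separated and of finite type over `K`
(with respect to the given structure morphism). -/
def IsVarietyOver (K : Type) [Field K] (X : Scheme)
    (sX : X ⟶ AlgebraicGeometry.Spec (CommRingCat.of K)) : Prop :=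
  IsIntegral X ∧ IsSeparated sX ∧ LocallyOfFiniteType sX ∧ QuasiCompact sX

/-- Algebras of finite type over a field have bounded Krull dimension. -/
lemma aux_ringKrullDim_bound {K R : Type*} [Field K] [CommRing R] (φ : K →+* R)
    (h : φ.FiniteType) : ∃ n : ℕ, ringKrullDim R ≤ n := by
  algebraize [φ]
  obtain ⟨n, g, hg⟩ := Algebra.FiniteType.iff_quotient_mvPolynomial''.mp
    (inferInstance : Algebra.FiniteType K R)
  refine ⟨n, (ringKrullDim_le_of_surjective g.toRingHom hg).trans ?_⟩
  rw [MvPolynomial.ringKrullDim_of_isNoetherianRing]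
  simp

lemma aux_coheight_bound {K : Type} [Field K] {S : Scheme}
    (sS : S ⟶ Spec (CommRingCat.of K)) [LocallyOfFiniteType sS] [CompactSpace S] :
    ∃ n : ℕ, ∀ x : S, Order.coheight x ≤ n := by
  have key : ∃ n : ℕ, ∀ x ∈ (Set.univ : Set S), Order.coheight x ≤ n := by
    refine isCompact_univ.induction_on (p := fun W => ∃ n : ℕ, ∀ x ∈ W, Order.coheight x ≤ n)
      ⟨0, by simp⟩ ?_ ?_ ?_
    · rintro s t hst ⟨n, hn⟩
      exact ⟨n, fun x hx => hn x (hst hx)⟩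
    · rintro s t ⟨n, hn⟩ ⟨m, hm⟩
      refine ⟨max n m, fun x hx => ?_⟩
      rcases hx with hx | hx
      · exact (hn x hx).trans (by exact_mod_cast le_max_left n m)
      · exact (hm x hx).trans (by exact_mod_cast le_max_right n m)
    · intro x _
      obtain ⟨R, f, hf, hx, -⟩ := Scheme.exists_affine_mem_range_and_range_subset
        (show x ∈ (⊤ : S.Opens) from trivial)
      obtain ⟨φ, hφ⟩ := Spec.map_surjective (f ≫ sS)
      have h1 : LocallyOfFiniteType (Spec.map φ) := by rw [hφ]; infer_instance
      rw [HasRingHomProperty.Spec_iff (P := @LocallyOfFiniteType)] at h1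
      obtain ⟨n, hn⟩ := aux_ringKrullDim_bound φ.hom h1
      refine ⟨Set.range f, mem_nhdsWithin_of_mem_nhds
        (f.isOpenEmbedding.isOpen_range.mem_nhds hx), n, ?_⟩
      rintro _ ⟨y, rfl⟩
      have h2 : Order.coheight (f y) = Order.coheight y := coheight_eq_of_isOpenImmersion f
      rw [h2, ← idealHeight_eq_coheight]
      have h3 : (y.asIdeal.height : WithBot ℕ∞) ≤ ringKrullDim R :=
        Ideal.height_le_ringKrullDim_of_ne_top y.isPrime.ne_top
      exact_mod_cast h3.trans hn
  obtain ⟨n, hn⟩ := key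
  exact ⟨n, fun x => hn x trivial⟩

lemma aux_topologicalKrullDim (X : Scheme) : topologicalKrullDim X = Order.krullDim X :=
  @Order.krullDim_eq_of_orderIso _ _ _ _ (irreducibleSetEquivPoints (α := X))

/-- No nontrivial specializations in fibres of finite morphisms. -/
lemma aux_strictMono {Z S : Scheme} (g : Z ⟶ S) [IsFinite g] :
    StrictMono (fun z : Z => g z) := by
  intro a b hab
  have h1 : b ⤳ a := hab.le
  have h2 : g b ⤳ g a := h1.map g.continuous
  refine lt_of_le_not_ge (show g a ≤ g b from h2) ?_
  intro hge
  have he : g a = g b := (Specializes.antisymm hge h2).eq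
  have hd := g.isDiscrete_preimage_singleton (g a)
  obtain ⟨u, hu, hua⟩ := isDiscrete_iff_forall_mem_exists_isOpen.mp hd a rfl
  have hau : a ∈ u := by
    have : a ∈ u ∩ (g ⁻¹' {g a}) := by rw [hua]; rfl
    exact this.1
  have hb : b ∈ u ∩ (g ⁻¹' {g a}) := ⟨h1.mem_open hu hau, he.symm⟩
  rw [hua] at hb
  exact hab.ne hb.symm

/-- If `f : C ⟶ S` is proper, `U ⊆ C` is open with `f|_U` affine, and `T ⊆ U`
is an irreducible closed subset of `C` of the same Krull dimension as `S`, then `f` restricted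
to `T` (with its reduced induced closed subscheme structure, here represented by any reduced
scheme `Z` with a closed immersion onto `T`) is finite and surjective onto `S`. -/
theorem restriction_to_dimension_preserving_closed_subset_is_finite_surjective
    (K : Type) [Field K] [IsAlgClosed K]
    (S C : Scheme)
    (sS : S ⟶ Spec (CommRingCat.of K)) (sC : C ⟶ Spec (CommRingCat.of K))
    (hS : IsVarietyOver K S sS)
    (hCsep : IsSeparated sC) (hClft : LocallyOfFiniteType sC) (hCqc : QuasiCompact sC)
    (f : C ⟶ S) (hfprop : IsProper f)
    (U : C.Opens) (hUaff : IsAffineHom (U.ι ≫ f))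
    (T : Set C) (hTirr : IsIrreducible T) (hTclosed : IsClosed T)
    (hTU : T ⊆ (U : Set C))
    (hTdim : topologicalKrullDim T = topologicalKrullDim S)
    (Z : Scheme) (i : Z ⟶ C) (hi : IsClosedImmersion i) (hZred : IsReduced Z)
    (hiT : Set.range i.base = T) :
    IsFinite (i ≫ f) ∧ Surjective (i ≫ f) := by
  obtain ⟨hSint, hSsep, hSlft, hSqc⟩ := hS
  have hfin : IsFinite (i ≫ f) := by
    have hr : Set.range i ⊆ Set.range U.ι := by
      rw [Scheme.Opens.range_ι]
      exact hiT.trans_subset hTU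
    have hfac := IsOpenImmersion.lift_fac U.ι i hr
    have h1 : IsClosedImmersion (IsOpenImmersion.lift U.ι i hr ≫ U.ι) := by
      rw [hfac]; exact hi
    have h2 : IsClosedImmersion (IsOpenImmersion.lift U.ι i hr) := IsClosedImmersion.of_comp _ U.ι
    refine (IsFinite.iff_isProper_and_isAffineHom).mpr ⟨inferInstance, ?_⟩
    rw [← hfac, Category.assoc]
    infer_instance
  refine ⟨hfin, ?_⟩
  have hcomp : CompactSpace S := by
    have := QuasiCompact.isCompact_preimage (f := sS) Set.univ isOpen_univ isCompact_univ
    exact ⟨by simpa using this⟩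
  obtain ⟨N, hN⟩ := aux_coheight_bound sS
  have hZS : Order.krullDim Z = Order.krullDim S := by
    rw [← aux_topologicalKrullDim, ← aux_topologicalKrullDim, ← hTdim]
    subst hiT
    exact IsHomeomorph.topologicalKrullDim_eq _ i.isEmbedding.toHomeomorph.isHomeomorph
  have hSle : Order.krullDim S ≤ N := by
    rw [Order.krullDim_eq_iSup_coheight]
    exact iSup_le fun x => by exact_mod_cast hN x
  have hSne : Nonempty S := inferInstance
  obtain ⟨n, hn⟩ : ∃ n : ℕ, Order.krullDim S = n := by
    have h0 : 0 ≤ Order.krullDim S := Order.krullDim_nonneg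
    generalize Order.krullDim S = d at *
    induction d with
    | bot => simp at h0
    | coe d =>
      have : d ≤ N := by exact_mod_cast hSle
      lift d to ℕ using ne_top_of_le_ne_top (by simp) this
      exact ⟨d, rfl⟩
  obtain ⟨l, hl⟩ := Order.le_krullDim_iff.mp (hZS.trans hn).ge
  -- the generic point of `S` lies in the image
  have hgen : ∃ z : Z, (i ≫ f) z = genericPoint S := by
    by_contra! hne
    let l' := l.map _ (aux_strictMono (i ≫ f))
    have hlt : l'.last < genericPoint S := by
      have hs : genericPoint S ⤳ l'.last := genericPoint_specializes _
      refine lt_of_le_not_ge hs fun hge => ?_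
      have he : l'.last = genericPoint S := (Specializes.antisymm hge hs).eq
      exact hne l.last he
    have h := Order.LTSeries.length_le_krullDim (l'.snoc (genericPoint S) hlt)
    rw [hn] at h
    have h' : (l'.snoc (genericPoint S) hlt).length ≤ n := by exact_mod_cast h
    have h'' : (l'.snoc (genericPoint S) hlt).length = l.length + 1 := rfl
    omega
  obtain ⟨z, hz⟩ := hgen
  refine ⟨fun s => ?_⟩
  have hcl : IsClosed (Set.range (i ≫ f)) := (i ≫ f).isClosedMap.isClosed_range
  exact (genericPoint_specializes s).mem_closed hcl ⟨z, hz⟩
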